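/- arXiv:0807.1241 — 2 statements merged into one kernel-verified Lean document; each statement's English description precedes it below -/
import Mathlib

section
/- Let k and ℓ be natural numbers with ℓ ≤ k, and let R be a commutative ring. In the monoid algebra MonoidAlgebra R (Equiv.Perm (Fin k)), the product of the element ∑_{ρ} ρ, where ρ ranges over all (k,ℓ)-block permutations of Fin k, with the element ∑_{τ} τ, where τ ranges over all (k,ℓ)-unshuffles of Fin k, equals the element ∑_{σ} σ, where σ ranges over all permutations of Fin k. -/
/-- A (k,ℓ)-shuffle: a permutation of `Fin k` strictly monotone on the first `ℓ`
indices and strictly monotone on the remaining indices. -/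
def IsShuffle (k ℓ : ℕ) (τ : Equiv.Perm (Fin k)) : Prop :=
  StrictMonoOn τ {i : Fin k | (i : ℕ) < ℓ} ∧ StrictMonoOn τ {i : Fin k | ℓ ≤ (i : ℕ)}

/-- A (k,ℓ)-unshuffle: the inverse of a (k,ℓ)-shuffle. -/
def IsUnshuffle (k ℓ : ℕ) (τ : Equiv.Perm (Fin k)) : Prop :=
  IsShuffle k ℓ τ⁻¹

/-- A (k,ℓ)-block permutation: a permutation of `Fin k` mapping the set of the
first `ℓ` indices onto itself. -/
def IsBlockPerm (k ℓ : ℕ) (ρ : Equiv.Perm (Fin k)) : Prop :=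
  ⇑ρ '' {i : Fin k | (i : ℕ) < ℓ} = {i : Fin k | (i : ℕ) < ℓ}

def keyFn (k ℓ : ℕ) (π : Equiv.Perm (Fin k)) (i : Fin k) : ℕ :=
  if (i : ℕ) < ℓ then (π i : ℕ) else k + (π i : ℕ)

theorem keyFn_inj (k ℓ : ℕ) (π : Equiv.Perm (Fin k)) : Function.Injective (keyFn k ℓ π) := by
  intro i j hij
  unfold keyFn at hij
  have h1 := (π i).isLt
  have h2 := (π j).isLt
  apply π.injective
  apply Fin.ext
  split_ifs at hij <;> omega

theorem blockPerm_iff (k ℓ : ℕ) (ρ : Equiv.Perm (Fin k)) :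
    IsBlockPerm k ℓ ρ ↔ ∀ i, ((ρ i : ℕ) < ℓ ↔ (i : ℕ) < ℓ) := by
  unfold IsBlockPerm
  constructor
  · intro h i
    have := Set.ext_iff.1 h (ρ i)
    simpa using this.symm
  · intro h
    ext x
    obtain ⟨i, rfl⟩ := ρ.surjective x
    simpa using (h i).symm

theorem mono_iff (k ℓ : ℕ) (π ρ : Equiv.Perm (Fin k)) :
    Monotone (keyFn k ℓ π ∘ ρ) ↔ IsBlockPerm k ℓ ρ ∧ IsShuffle k ℓ (π * ρ) := by
  rw [blockPerm_iff]
  constructor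
  · intro hm
    have hb : ∀ i, ((ρ i : ℕ) < ℓ ↔ (i : ℕ) < ℓ) := by
      let g : Fin k → ℕ := fun i => if (i : ℕ) < ℓ then 0 else 1
      have hg : Monotone (g ∘ (1 : Equiv.Perm (Fin k))) := by
        intro i j hij
        have : (i : ℕ) ≤ j := hij
        simp only [g, Function.comp, Equiv.Perm.coe_one, id]
        split_ifs <;> omega
      have hg2 : Monotone (g ∘ ρ) := by
        intro i j hij
        have h3 := hm hij
        have h1 := (π (ρ i)).isLt
        have h2 := (π (ρ j)).isLt
        simp only [g, Function.comp, keyFn] at h3 ⊢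
        split_ifs at h3 ⊢ <;> omega
      have e := (Tuple.comp_sort_eq_comp_iff_monotone.2 hg2).trans
        (Tuple.comp_sort_eq_comp_iff_monotone.2 hg).symm
      intro i
      have := congrFun e i
      simp only [g, Function.comp, Equiv.Perm.coe_one, id] at this
      split_ifs at this <;> omega
    have hs : StrictMono (keyFn k ℓ π ∘ ρ) :=
      hm.strictMono_of_injective ((keyFn_inj k ℓ π).comp ρ.injective)
    refine ⟨hb, ?_, ?_⟩ <;>
    · intro i hi j hj hij
      have h3 := hs hij
      have h4 := hb i
      have h5 := hb j
      simp only [Set.mem_setOf_eq] at hi hj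
      simp only [Function.comp, keyFn] at h3
      rw [Fin.lt_def, Equiv.Perm.mul_apply, Equiv.Perm.mul_apply]
      split_ifs at h3 <;> omega
  · rintro ⟨hb, h1, h2⟩
    apply StrictMono.monotone
    intro i j hij
    have h4 := hb i
    have h5 := hb j
    have h6 := (π (ρ i)).isLt
    have h7 : (i : ℕ) < j := hij
    simp only [Function.comp, keyFn]
    by_cases hi : (i : ℕ) < ℓ <;> by_cases hj : (j : ℕ) < ℓ
    · have : (π (ρ i) : ℕ) < π (ρ j) := h1 hi hj hij
      split_ifs <;> omega
    · split_ifs <;> omega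
    · omega
    · have : (π (ρ i) : ℕ) < π (ρ j) := h2 (not_lt.1 hi) (not_lt.1 hj) hij
      split_ifs <;> omega

open scoped Classical in
/-- In the monoid algebra, (sum of block permutations) * (sum of unshuffles)
equals the sum of all permutations. -/
theorem blockSum_mul_unshuffleSum (k ℓ : ℕ) (h : ℓ ≤ k) (R : Type*) [CommRing R] :
    ((∑ ρ ∈ Finset.univ.filter (fun ρ => IsBlockPerm k ℓ ρ),
        MonoidAlgebra.of R (Equiv.Perm (Fin k)) ρ) *
      (∑ τ ∈ Finset.univ.filter (fun τ => IsUnshuffle k ℓ τ),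
        MonoidAlgebra.of R (Equiv.Perm (Fin k)) τ)) =
    ∑ σ : Equiv.Perm (Fin k), MonoidAlgebra.of R (Equiv.Perm (Fin k)) σ := by
  rw [Finset.sum_mul_sum, ← Finset.sum_product']
  refine Finset.sum_bij (fun p _ => p.1 * p.2) (fun _ _ => Finset.mem_univ _) ?_ ?_ ?_
  · rintro ⟨ρ, τ⟩ hp ⟨ρ', τ'⟩ hp' e
    simp only [Finset.mem_product, Finset.mem_filter, Finset.mem_univ, true_and] at hp hp' e
    have m1 : Monotone (keyFn k ℓ (ρ * τ)⁻¹ ∘ ρ) := by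
      rw [mono_iff]
      refine ⟨hp.1, ?_⟩
      have := hp.2
      unfold IsUnshuffle at this
      simpa using this
    have m2 : Monotone (keyFn k ℓ (ρ * τ)⁻¹ ∘ ρ') := by
      rw [mono_iff, e]
      refine ⟨hp'.1, ?_⟩
      have := hp'.2
      unfold IsUnshuffle at this
      simpa using this
    have e2 := (Tuple.comp_sort_eq_comp_iff_monotone.2 m1).trans
        (Tuple.comp_sort_eq_comp_iff_monotone.2 m2).symm
    have e3 : ρ = ρ' := Equiv.ext fun i => keyFn_inj k ℓ _ (congrFun e2 i)
    subst e3
    rw [mul_left_cancel e]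
  · intro σ _
    have m := (mono_iff k ℓ σ⁻¹ _).1 (Tuple.monotone_sort (keyFn k ℓ σ⁻¹))
    refine ⟨(Tuple.sort (keyFn k ℓ σ⁻¹), (Tuple.sort (keyFn k ℓ σ⁻¹))⁻¹ * σ), ?_, by simp⟩
    simp only [Finset.mem_product, Finset.mem_filter, Finset.mem_univ, true_and]
    refine ⟨m.1, ?_⟩
    unfold IsUnshuffle
    simpa using m.2
  · intro p _
    rw [map_mul]
end

section
/- Let k and ℓ be natural numbers with ℓ ≤ k. In the monoid algebra MonoidAlgebra ℚ (Equiv.Perm (Fin k)), the product of the element (1/(ℓ! · (k−ℓ)!)) • ∑_{ρ} ρ, where ρ ranges over all (k,ℓ)-block permutations of Fin k, with the element ∑_{τ} τ, where τ ranges over all (k,ℓ)-unshuffles of Fin k, equals (k choose ℓ) • ((1/k!) • ∑_{σ} σ), where σ ranges over all permutations of Fin k. -/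
theorem isBlockPerm_iff (k ℓ : ℕ) (ρ : Equiv.Perm (Fin k)) :
    IsBlockPerm k ℓ ρ ↔ ∀ i, (ℓ ≤ (ρ i : ℕ) ↔ ℓ ≤ (i : ℕ)) := by
  unfold IsBlockPerm
  constructor
  · intro h i
    have h2 : ρ i ∈ ⇑ρ '' {i : Fin k | (i : ℕ) < ℓ} ↔ ρ i ∈ {i : Fin k | (i : ℕ) < ℓ} := by
      rw [h]
    rw [ρ.injective.mem_set_image] at h2
    simp only [Set.mem_setOf_eq] at h2
    omega
  · intro h
    ext j
    obtain ⟨i, rfl⟩ := ρ.surjective j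
    rw [ρ.injective.mem_set_image]
    have := h i
    simp only [Set.mem_setOf_eq]
    omega

/-- The sorting key. -/
def blockKey (k ℓ : ℕ) (π : Equiv.Perm (Fin k)) (i : Fin k) : Bool ×ₗ Fin k :=
  toLex (decide (ℓ ≤ (i : ℕ)), π i)

theorem blockKey_injective (k ℓ : ℕ) (π : Equiv.Perm (Fin k)) :
    Function.Injective (blockKey k ℓ π) := by
  intro i j h
  have := congrArg (fun x => (ofLex x).2) h
  exact π.injective this

theorem key_le_iff (k ℓ : ℕ) (π : Equiv.Perm (Fin k)) (i j : Fin k) :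
    blockKey k ℓ π i ≤ blockKey k ℓ π j ↔
      ((i : ℕ) < ℓ ∧ ℓ ≤ (j : ℕ)) ∨ ((ℓ ≤ (i : ℕ) ↔ ℓ ≤ (j : ℕ)) ∧ π i ≤ π j) := by
  unfold blockKey
  rw [Prod.Lex.toLex_le_toLex]
  simp [Bool.lt_iff]

theorem block_shuffle_iff (k ℓ : ℕ) (π ρ : Equiv.Perm (Fin k)) :
    (IsBlockPerm k ℓ ρ ∧ IsShuffle k ℓ (π * ρ)) ↔ Monotone (blockKey k ℓ π ∘ ρ) := by
  constructor
  · rintro ⟨hb, h1, h2⟩ i j hij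
    rw [isBlockPerm_iff] at hb
    simp only [Function.comp]
    rw [key_le_iff]
    have hi := hb i
    have hj := hb j
    have hij' : (i : ℕ) ≤ j := hij
    by_cases a : ℓ ≤ (i : ℕ)
    · exact Or.inr ⟨by omega, h2.monotoneOn a (by simp only [Set.mem_setOf_eq]; omega) hij⟩
    · by_cases b : ℓ ≤ (j : ℕ)
      · left; omega
      · exact Or.inr ⟨by omega, h1.monotoneOn (by simp only [Set.mem_setOf_eq]; omega)
          (by simp only [Set.mem_setOf_eq]; omega) hij⟩
  · intro hm
    have hb : ∀ i, (ℓ ≤ (ρ i : ℕ) ↔ ℓ ≤ (i : ℕ)) := by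
      let f : Fin k → Bool := fun i => decide (ℓ ≤ (i : ℕ))
      have m1 : Monotone (f ∘ ρ) := by
        intro i j hij
        have := hm hij
        simp only [Function.comp] at this
        rw [key_le_iff] at this
        simp only [f, Function.comp, Bool.le_iff_imp, decide_eq_true_eq]
        omega
      have m2 : Monotone (f ∘ (1 : Equiv.Perm (Fin k))) := by
        intro i j hij
        have hij' : (i : ℕ) ≤ j := hij
        simp only [f, Function.comp, Bool.le_iff_imp, decide_eq_true_eq, Equiv.Perm.one_apply]
        omega
      intro i
      have := congrFun (Tuple.unique_monotone m1 m2) i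
      simpa [f] using this
    refine ⟨(isBlockPerm_iff k ℓ ρ).2 hb, ?_, ?_⟩
    all_goals
      intro i hi j hj hij
      have hle := hm hij.le
      simp only [Function.comp] at hle
      rw [key_le_iff] at hle
      simp only [Set.mem_setOf_eq] at hi hj
      have h1 := hb i
      have h2 := hb j
      refine lt_of_le_of_ne ?_ (fun e => hij.ne ((π * ρ).injective e))
      rcases hle with h3 | h3
      · omega
      · exact h3.2

theorem exists_block (k ℓ : ℕ) (π : Equiv.Perm (Fin k)) :
    ∃ ρ, IsBlockPerm k ℓ ρ ∧ IsShuffle k ℓ (π * ρ) :=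
  ⟨Tuple.sort (blockKey k ℓ π), (block_shuffle_iff k ℓ π _).2 (Tuple.monotone_sort _)⟩

theorem unique_block (k ℓ : ℕ) (π ρ ρ' : Equiv.Perm (Fin k))
    (h : IsBlockPerm k ℓ ρ ∧ IsShuffle k ℓ (π * ρ))
    (h' : IsBlockPerm k ℓ ρ' ∧ IsShuffle k ℓ (π * ρ')) : ρ = ρ' := by
  rw [block_shuffle_iff] at h h'
  ext1 i
  exact blockKey_injective k ℓ π (congrFun (Tuple.unique_monotone h h') i)

open scoped Classical in
/-- Group-algebra form of the first diagram of Lemma A.2: the partial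
symmetrizer times the sum over unshuffles equals `(k choose ℓ)` times the full
symmetrizer. -/
theorem partialSymmetrizer_mul_unshuffleSum (k ℓ : ℕ) (h : ℓ ≤ k) :
    (((1 : ℚ) / (Nat.factorial ℓ * Nat.factorial (k - ℓ))) •
        ∑ ρ ∈ Finset.univ.filter (fun ρ => IsBlockPerm k ℓ ρ),
          MonoidAlgebra.of ℚ (Equiv.Perm (Fin k)) ρ) *
      (∑ τ ∈ Finset.univ.filter (fun τ => IsUnshuffle k ℓ τ),
        MonoidAlgebra.of ℚ (Equiv.Perm (Fin k)) τ) =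
    (k.choose ℓ) • (((1 : ℚ) / (Nat.factorial k)) •
      ∑ σ : Equiv.Perm (Fin k), MonoidAlgebra.of ℚ (Equiv.Perm (Fin k)) σ) := by
  have key : (∑ ρ ∈ Finset.univ.filter (fun ρ => IsBlockPerm k ℓ ρ),
          MonoidAlgebra.of ℚ (Equiv.Perm (Fin k)) ρ) *
      (∑ τ ∈ Finset.univ.filter (fun τ => IsUnshuffle k ℓ τ),
        MonoidAlgebra.of ℚ (Equiv.Perm (Fin k)) τ) =
      ∑ σ : Equiv.Perm (Fin k), MonoidAlgebra.of ℚ (Equiv.Perm (Fin k)) σ := by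
    rw [Finset.sum_mul_sum, ← Finset.sum_product']
    refine Finset.sum_bij (fun p _ => p.1 * p.2) (fun _ _ => Finset.mem_univ _) ?_ ?_ ?_
    · rintro ⟨ρ, τ⟩ hp ⟨ρ', τ'⟩ hp' he
      simp only [Finset.mem_product, Finset.mem_filter, Finset.mem_univ, true_and] at hp hp' he
      have e1 : (ρ * τ)⁻¹ * ρ = τ⁻¹ := by group
      have e2 : (ρ * τ)⁻¹ * ρ' = τ'⁻¹ := by rw [he]; group
      have hρ : ρ = ρ' := unique_block k ℓ (ρ * τ)⁻¹ ρ ρ'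
        ⟨hp.1, by rw [e1]; exact hp.2⟩ ⟨hp'.1, by rw [e2]; exact hp'.2⟩
      subst hρ
      rw [mul_left_cancel he]
    · intro σ _
      obtain ⟨ρ, hb, hs⟩ := exists_block k ℓ σ⁻¹
      refine ⟨(ρ, ρ⁻¹ * σ), ?_, by simp⟩
      simp only [Finset.mem_product, Finset.mem_filter, Finset.mem_univ, true_and]
      refine ⟨hb, ?_⟩
      unfold IsUnshuffle
      simpa using hs
    · rintro ⟨ρ, τ⟩ _
      simp only [map_mul]
  rw [smul_mul_assoc, key, ← Nat.cast_smul_eq_nsmul ℚ, smul_smul]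
  congr 1
  rw [Nat.cast_choose ℚ h]
  have := Nat.factorial_ne_zero k
  field_simp
end
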